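/- Let t ∈ ℝ satisfy c₀^t < e^{P(t)} and c₁^t < e^{P(t)}. Then Q(t) = P(t). -/

import Mathlib

open Filter

/-- The weight `c_ω` of a word `ω` over the alphabet `{0,1}` (here `false` is the
letter 0 and `true` is the letter 1): the product of `c0` over letters 0 and `c1`
over letters 1. -/
noncomputable def wt (c0 c1 : ℝ) (w : List Bool) : ℝ :=
  (w.map fun b => if b then c1 else c0).prod

/-- All words of length `n` over the alphabet `{0,1}`. -/
def allWords : ℕ → Finset (List Bool)
  | 0 => {[]}
  | n + 1 => (allWords n).biUnion fun w => {false :: w, true :: w}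

/-- Membership in the language of the S-gap shift: every maximal block of 0s lying
strictly between two 1s has length in `S`. -/
def InLang (S : Set ℕ) (w : List Bool) : Prop :=
  ∀ u v : List Bool, ∀ m : ℕ,
    w = u ++ [true] ++ List.replicate m false ++ [true] ++ v → m ∈ S

/-- Membership in the core set `G`: words of the form `0^{s₁}1 0^{s₂}1 ⋯ 0^{s_k}1`
with `k ≥ 1` and every `s_i ∈ S`. -/
def InCore (S : Set ℕ) (w : List Bool) : Prop :=
  ∃ bs : List ℕ, bs ≠ [] ∧ (∀ s ∈ bs, s ∈ S) ∧
    w = (bs.map fun s => List.replicate s false ++ [true]).flatten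

/-- `L_n`: the words of length `n` in the language of the S-gap shift. -/
noncomputable def langWords (S : Set ℕ) (n : ℕ) : Finset (List Bool) :=
  @Finset.filter _ (InLang S) (Classical.decPred _) (allWords n)

/-- `G_n`: the core words of length `n`. -/
noncomputable def coreWords (S : Set ℕ) (n : ℕ) : Finset (List Bool) :=
  @Finset.filter _ (InCore S) (Classical.decPred _) (allWords n)

/-- Extended-real logarithm with `log 0 = -∞`. -/
noncomputable def elog (x : ℝ) : EReal := if x = 0 then ⊥ else ((Real.log x : ℝ) : EReal)

/-- `Q(t) = limsup_{n → ∞} (1/n) log (∑_{ω ∈ G_n} c_ω^t)`, taken in the extended reals. -/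
noncomputable def Qfun (S : Set ℕ) (c0 c1 : ℝ) (t : ℝ) : EReal :=
  limsup (fun n : ℕ =>
    ((1 / (n : ℝ) : ℝ) : EReal) * elog (∑ ω ∈ coreWords S n, wt c0 c1 ω ^ t)) atTop

theorem wt_pos {c0 c1 : ℝ} (hc0 : 0 < c0) (hc1 : 0 < c1) (w : List Bool) : 0 < wt c0 c1 w := by
  refine List.prod_pos fun a ha => ?_
  obtain ⟨b, -, rfl⟩ := List.mem_map.1 ha
  cases b <;> simpa

theorem wt_append (c0 c1 : ℝ) (u v : List Bool) :
    wt c0 c1 (u ++ v) = wt c0 c1 u * wt c0 c1 v := by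
  simp [wt]

theorem mem_allWords {n : ℕ} {w : List Bool} : w ∈ allWords n ↔ w.length = n := by
  induction n generalizing w with
  | zero => simp [allWords]
  | succ n ih =>
    cases w with
    | nil => simp [allWords]
    | cons b w => cases b <;> simp [allWords, ih]

theorem mem_langWords {S : Set ℕ} {n : ℕ} {w : List Bool} :
    w ∈ langWords S n ↔ w.length = n ∧ InLang S w := by
  simp [langWords, mem_allWords]

theorem mem_coreWords {S : Set ℕ} {n : ℕ} {w : List Bool} :
    w ∈ coreWords S n ↔ w.length = n ∧ InCore S w := by
  simp [coreWords, mem_allWords]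

/-- The words `w` of length `n` such that `1w` is in the language. -/
noncomputable def followerWords (S : Set ℕ) (n : ℕ) : Finset (List Bool) :=
  @Finset.filter _ (fun w => InLang S (true :: w)) (Classical.decPred _) (allWords n)

theorem mem_followerWords {S : Set ℕ} {n : ℕ} {w : List Bool} :
    w ∈ followerWords S n ↔ w.length = n ∧ InLang S (true :: w) := by
  simp [followerWords, mem_allWords]

theorem InLang.of_append_left {S : Set ℕ} {w z : List Bool} (h : InLang S (w ++ z)) :
    InLang S w := by
  intro u v m e
  exact h u (v ++ z) m (by simp [e])

theorem InLang.of_append_right {S : Set ℕ} {w z : List Bool} (h : InLang S (z ++ w)) :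
    InLang S w := by
  intro u v m e
  exact h (z ++ u) v m (by simp [e])

theorem inLang_replicate_false (S : Set ℕ) (n : ℕ) : InLang S (List.replicate n false) := by
  intro u v m e
  have : true ∈ List.replicate n false := by rw [e]; simp
  simp at this

theorem eq_replicate_or_eq_append_true (w : List Bool) :
    (∃ n, w = List.replicate n false) ∨
      ∃ a z, w = List.replicate a false ++ true :: z := by
  induction w with
  | nil => exact Or.inl ⟨0, rfl⟩
  | cons b w ih =>
    cases b with
    | true => exact Or.inr ⟨0, w, rfl⟩
    | false =>
      obtain ⟨n, rfl⟩ | ⟨a, z, rfl⟩ := ih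
      · exact Or.inl ⟨n + 1, rfl⟩
      · exact Or.inr ⟨a + 1, z, rfl⟩

theorem replicate_append_true_inj {a b : ℕ} {u v : List Bool}
    (h : List.replicate a false ++ true :: u = List.replicate b false ++ true :: v) :
    a = b ∧ u = v := by
  induction a generalizing b with
  | zero => cases b <;> simp_all [List.replicate_succ]
  | succ a ih =>
    cases b with
    | zero => simp [List.replicate_succ] at h
    | succ b =>
      simp only [List.replicate_succ, List.cons_append, List.cons.injEq, true_and] at h
      simpa using ih h

theorem inCore_append_true {S : Set ℕ} {w : List Bool} (h : InLang S (true :: (w ++ [true]))) :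
    InCore S (w ++ [true]) := by
  induction hn : w.length using Nat.strong_induction_on generalizing w with
  | _ n ih =>
    obtain ⟨m, rfl⟩ | ⟨a, z, rfl⟩ := eq_replicate_or_eq_append_true w
    · have hm : m ∈ S := h [] [] m (by simp)
      exact ⟨[m], by simp, by simpa using hm, by simp⟩
    · have ha : a ∈ S := h [] (z ++ [true]) a (by simp)
      have hz : InLang S (true :: (z ++ [true])) := by
        refine InLang.of_append_right (z := true :: List.replicate a false) ?_
        simpa using h
      obtain ⟨bs, -, hbs, e⟩ := ih z.length (by simp at hn; omega) hz rfl
      refine ⟨a :: bs, by simp, by simpa using ⟨ha, hbs⟩, ?_⟩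
      simp [← e]

theorem inLang_blocks {S : Set ℕ} (bs : List ℕ) (hbs : ∀ s ∈ bs, s ∈ S) :
    InLang S (bs.map fun s => List.replicate s false ++ [true]).flatten := by
  induction bs with
  | nil => intro u v m e; simp at e
  | cons s bs ih =>
    have hbs' : ∀ s ∈ bs, s ∈ S := fun s hs => hbs s (by simp [hs])
    intro u v m e
    obtain ⟨a, rfl⟩ | ⟨a, z, rfl⟩ := eq_replicate_or_eq_append_true u
    · simp only [List.map_cons, List.flatten_cons, List.append_assoc, List.singleton_append] at e
      have e' := (replicate_append_true_inj e).2
      cases bs with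
      | nil => simp at e'
      | cons s' bs =>
        simp only [List.map_cons, List.flatten_cons, List.append_assoc,
          List.singleton_append] at e'
        rw [← (replicate_append_true_inj e').1]
        exact hbs' s' (by simp)
    · simp only [List.map_cons, List.flatten_cons, List.append_assoc,
        List.cons_append] at e
      exact ih hbs' z v m (by simpa using (replicate_append_true_inj e).2)

theorem InCore.inLang {S : Set ℕ} {w : List Bool} (h : InCore S w) : InLang S w := by
  obtain ⟨bs, -, hbs, rfl⟩ := h
  exact inLang_blocks bs hbs

theorem coreWords_subset_langWords (S : Set ℕ) (n : ℕ) : coreWords S n ⊆ langWords S n := by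
  intro w hw
  rw [mem_coreWords] at hw
  exact mem_langWords.2 ⟨hw.1, hw.2.inLang⟩

theorem followerWords_succ_subset (S : Set ℕ) (n : ℕ) :
    followerWords S (n + 1) ⊆
      (followerWords S n).image (fun w => w ++ [false]) ∪ coreWords S (n + 1) := by
  intro w hw
  rw [mem_followerWords] at hw
  obtain rfl | ⟨z, b, rfl⟩ := w.eq_nil_or_concat'
  · simp at hw
  · obtain ⟨hl, hw⟩ := hw
    rw [Finset.mem_union]
    cases b with
    | false =>
      refine Or.inl (Finset.mem_image.2 ⟨z, mem_followerWords.2 ⟨by simpa using hl, ?_⟩, rfl⟩)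
      exact InLang.of_append_left (z := [false]) (by simpa using hw)
    | true => exact Or.inr (mem_coreWords.2 ⟨hl, inCore_append_true hw⟩)

theorem langWords_succ_subset (S : Set ℕ) (n : ℕ) :
    langWords S (n + 1) ⊆
      (langWords S n).image (List.cons false) ∪ (followerWords S n).image (List.cons true) := by
  intro w hw
  rw [mem_langWords] at hw
  obtain ⟨hl, hw⟩ := hw
  cases w with
  | nil => simp at hl
  | cons b w =>
    rw [Finset.mem_union, Finset.mem_image, Finset.mem_image]
    cases b with
    | false =>
      exact Or.inl ⟨w, mem_langWords.2 ⟨by simpa using hl,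
        InLang.of_append_right (z := [false]) hw⟩, rfl⟩
    | true => exact Or.inr ⟨w, mem_followerWords.2 ⟨by simpa using hl, hw⟩, rfl⟩

theorem Finset.sum_le_sum_add_sum_of_subset_union {α : Type*} [DecidableEq α] {f : α → ℝ}
    (hf : ∀ a, 0 ≤ f a) {A B C : Finset α} (h : A ⊆ B ∪ C) :
    ∑ a ∈ A, f a ≤ ∑ a ∈ B, f a + ∑ a ∈ C, f a := by
  rw [← Finset.sum_union_inter]
  have h1 := Finset.sum_le_sum_of_subset_of_nonneg h fun a _ _ => hf a
  have h2 : 0 ≤ ∑ a ∈ B ∩ C, f a := Finset.sum_nonneg fun a _ => hf a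
  linarith

theorem wt_append_rpow {c0 c1 : ℝ} (hc0 : 0 < c0) (hc1 : 0 < c1) (t : ℝ)
    (u v : List Bool) :
    wt c0 c1 (u ++ v) ^ t = wt c0 c1 u ^ t * wt c0 c1 v ^ t := by
  rw [wt_append, Real.mul_rpow (wt_pos hc0 hc1 u).le (wt_pos hc0 hc1 v).le]

theorem sum_followerWords_succ_le {c0 c1 : ℝ} (hc0 : 0 < c0) (hc1 : 0 < c1) (t : ℝ)
    (S : Set ℕ) (n : ℕ) :
    ∑ w ∈ followerWords S (n + 1), wt c0 c1 w ^ t ≤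
      c0 ^ t * ∑ w ∈ followerWords S n, wt c0 c1 w ^ t +
        ∑ w ∈ coreWords S (n + 1), wt c0 c1 w ^ t := by
  refine (Finset.sum_le_sum_add_sum_of_subset_union
    (fun w => (Real.rpow_pos_of_pos (wt_pos hc0 hc1 w) t).le)
    (followerWords_succ_subset S n)).trans_eq ?_
  rw [Finset.sum_image (List.append_left_injective [false]).injOn, Finset.mul_sum]
  congr 1
  refine Finset.sum_congr rfl fun w _ => ?_
  rw [wt_append_rpow hc0 hc1, mul_comm]
  simp [wt]

theorem sum_langWords_succ_le {c0 c1 : ℝ} (hc0 : 0 < c0) (hc1 : 0 < c1) (t : ℝ)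
    (S : Set ℕ) (n : ℕ) :
    ∑ w ∈ langWords S (n + 1), wt c0 c1 w ^ t ≤
      c0 ^ t * ∑ w ∈ langWords S n, wt c0 c1 w ^ t +
        c1 ^ t * ∑ w ∈ followerWords S n, wt c0 c1 w ^ t := by
  refine (Finset.sum_le_sum_add_sum_of_subset_union
    (fun w => (Real.rpow_pos_of_pos (wt_pos hc0 hc1 w) t).le)
    (langWords_succ_subset S n)).trans_eq ?_
  rw [Finset.sum_image (List.cons_injective).injOn, Finset.sum_image (List.cons_injective).injOn,
    Finset.mul_sum, Finset.mul_sum]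
  congr 1
  · refine Finset.sum_congr rfl fun w _ => ?_
    rw [← List.singleton_append, wt_append_rpow hc0 hc1]
    simp [wt]
  · refine Finset.sum_congr rfl fun w _ => ?_
    rw [← List.singleton_append, wt_append_rpow hc0 hc1]
    simp [wt]

theorem sum_langWords_pos {c0 c1 : ℝ} (hc0 : 0 < c0) (hc1 : 0 < c1) (t : ℝ)
    (S : Set ℕ) (n : ℕ) : 0 < ∑ w ∈ langWords S n, wt c0 c1 w ^ t :=
  Finset.sum_pos (fun w _ => Real.rpow_pos_of_pos (wt_pos hc0 hc1 w) t)
    ⟨List.replicate n false, mem_langWords.2 ⟨by simp, inLang_replicate_false S n⟩⟩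

theorem sum_le_one_of_subset_allWords_zero {c0 c1 : ℝ} (t : ℝ)
    {A : Finset (List Bool)} (hA : A ⊆ allWords 0) :
    ∑ w ∈ A, wt c0 c1 w ^ t ≤ 1 := by
  refine (Finset.sum_le_sum_of_subset_of_nonneg hA fun w hw _ => ?_).trans ?_
  · have : w = [] := by simpa [allWords] using hw
    simp [this, wt]
  · simp [allWords, wt]

theorem sum_followerWords_le {c0 c1 : ℝ} (hc0 : 0 < c0) (hc1 : 0 < c1) (t : ℝ)
    (S : Set ℕ) {C ρ : ℝ} (hC : 1 ≤ C) (hρ : c0 ^ t ≤ ρ)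
    (hg : ∀ n, ∑ w ∈ coreWords S n, wt c0 c1 w ^ t ≤ C * ρ ^ n) (n : ℕ) :
    ∑ w ∈ followerWords S n, wt c0 c1 w ^ t ≤ C * (n + 1) * ρ ^ n := by
  have hρ0 : 0 < ρ := (Real.rpow_pos_of_pos hc0 t).trans_le hρ
  induction n with
  | zero =>
    refine (sum_le_one_of_subset_allWords_zero t (@Finset.filter_subset _ _ (_) _)).trans ?_
    simpa using hC
  | succ n ih =>
    refine (sum_followerWords_succ_le hc0 hc1 t S n).trans ?_
    have h : c0 ^ t * ∑ w ∈ followerWords S n, wt c0 c1 w ^ t ≤ ρ * (C * (n + 1) * ρ ^ n) :=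
      mul_le_mul hρ ih (Finset.sum_nonneg fun w _ =>
        (Real.rpow_pos_of_pos (wt_pos hc0 hc1 w) t).le) hρ0.le
    refine (add_le_add h (hg (n + 1))).trans_eq ?_
    push_cast
    ring

/-- If the core sums grow at most like `ρ ^ n`, so do the language sums, up to a quadratic
factor. -/
theorem exists_sum_langWords_le {c0 c1 : ℝ} (hc0 : 0 < c0) (hc1 : 0 < c1) (t : ℝ)
    (S : Set ℕ) {C ρ : ℝ} (hC : 1 ≤ C) (hρ : c0 ^ t ≤ ρ)
    (hg : ∀ n, ∑ w ∈ coreWords S n, wt c0 c1 w ^ t ≤ C * ρ ^ n) :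
    ∃ D : ℝ, 0 < D ∧
      ∀ n : ℕ, ∑ w ∈ langWords S n, wt c0 c1 w ^ t ≤ D * (n + 1) ^ 2 * ρ ^ n := by
  have hρ0 : 0 < ρ := (Real.rpow_pos_of_pos hc0 t).trans_le hρ
  have hy : 0 < c1 ^ t := Real.rpow_pos_of_pos hc1 t
  have hD : 1 ≤ C * (1 + c1 ^ t / ρ) := by
    have : 0 < c1 ^ t / ρ := by positivity
    nlinarith
  refine ⟨C * (1 + c1 ^ t / ρ), by linarith, fun n => ?_⟩
  set D := C * (1 + c1 ^ t / ρ) with hD'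
  induction n with
  | zero =>
    refine (sum_le_one_of_subset_allWords_zero t (@Finset.filter_subset _ _ (_) _)).trans ?_
    simpa using hD
  | succ n ih =>
    refine (sum_langWords_succ_le hc0 hc1 t S n).trans ?_
    have h : c0 ^ t * ∑ w ∈ langWords S n, wt c0 c1 w ^ t ≤ ρ * (D * (n + 1) ^ 2 * ρ ^ n) :=
      mul_le_mul hρ ih (sum_langWords_pos hc0 hc1 t S n).le hρ0.le
    have h' := mul_le_mul_of_nonneg_left (sum_followerWords_le hc0 hc1 t S hC hρ hg n) hy.le
    refine (add_le_add h h').trans ?_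
    have hyD : c1 ^ t * C ≤ D * ρ := by
      have : D * ρ = C * ρ + c1 ^ t * C := by rw [hD']; field_simp
      have : 0 < C * ρ := by positivity
      linarith
    calc ρ * (D * (n + 1) ^ 2 * ρ ^ n) + c1 ^ t * (C * (n + 1) * ρ ^ n)
        = D * (n + 1) ^ 2 * ρ ^ (n + 1) + (c1 ^ t * C) * ((n + 1) * ρ ^ n) := by ring
      _ ≤ D * (n + 1) ^ 2 * ρ ^ (n + 1) + (D * ρ) * ((n + 1) * ρ ^ n) := by gcongr
      _ = D * ((n + 1) ^ 2 + (n + 1)) * ρ ^ (n + 1) := by ring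
      _ ≤ D * ((n + 1 : ℕ) + 1) ^ 2 * ρ ^ (n + 1) := by
        gcongr
        push_cast
        nlinarith [(Nat.cast_nonneg n : (0 : ℝ) ≤ n)]

theorem exists_forall_le_mul_pow {g : ℕ → ℝ} {ρ : ℝ} (hg : ∀ n, 0 ≤ g n) (hρ : 0 < ρ)
    (h : ∀ᶠ n in atTop, g n ≤ ρ ^ n) : ∃ C, 1 ≤ C ∧ ∀ n, g n ≤ C * ρ ^ n := by
  obtain ⟨N, hN⟩ := eventually_atTop.1 h
  have hpos : ∀ n, 0 ≤ g n / ρ ^ n := fun n => div_nonneg (hg n) (by positivity)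
  have hs : 0 ≤ ∑ k ∈ Finset.range N, g k / ρ ^ k := Finset.sum_nonneg fun k _ => hpos k
  refine ⟨1 + ∑ k ∈ Finset.range N, g k / ρ ^ k, by linarith, fun n => ?_⟩
  rw [← div_le_iff₀ (by positivity)]
  by_cases hn : n < N
  · have := Finset.single_le_sum (fun k _ => hpos k) (Finset.mem_range.2 hn)
    linarith
  · have := (div_le_one (by positivity)).2 (hN n (not_lt.1 hn))
    linarith

theorem tendsto_log_quadratic_mul_exp {D : ℝ} (hD : 0 < D) (r : ℝ) :
    Tendsto (fun n : ℕ => (1 / (n : ℝ)) * Real.log (D * (n + 1) ^ 2 * Real.exp r ^ n))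
      atTop (nhds r) := by
  have h1 : Tendsto (fun n : ℕ => Real.log D / n) atTop (nhds 0) :=
    tendsto_const_div_atTop_nhds_zero_nat _
  have h2 : Tendsto (fun n : ℕ => Real.log ((n : ℝ) + 1) / n) atTop (nhds 0) := by
    have := (Real.tendsto_pow_log_div_mul_add_atTop 1 (-1) 1 one_ne_zero).comp
      (tendsto_atTop_add_const_right _ (1 : ℝ) (tendsto_natCast_atTop_atTop (R := ℝ)))
    simpa [Function.comp_def] using this
  have h3 := (h1.add (h2.const_mul 2)).add_const r
  simp only [mul_zero, add_zero, zero_add] at h3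
  refine h3.congr' ?_
  filter_upwards [eventually_gt_atTop 0] with n hn
  have hn' : (0 : ℝ) < n := by exact_mod_cast hn
  rw [Real.log_mul (by positivity) (by positivity), Real.log_mul (by positivity) (by positivity),
    Real.log_pow, Real.log_pow, Real.log_exp]
  field_simp
  push_cast
  ring

theorem elog_of_pos {x : ℝ} (hx : 0 < x) : elog x = (Real.log x : EReal) := by
  simp [elog, hx.ne']

theorem inv_mul_elog_zero {n : ℕ} (hn : 0 < n) :
    ((1 / (n : ℝ) : ℝ) : EReal) * elog 0 = ⊥ := by
  rw [elog, if_pos rfl]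
  exact EReal.coe_mul_bot_of_pos (by positivity)

/-- If c₀^t < e^{P(t)} and c₁^t < e^{P(t)}, then Q(t) = P(t). -/
theorem stmt6
    (S : Set ℕ) (hS : S.Infinite)
    (c0 c1 cb0 cb1 : ℝ)
    (hc0 : 0 < c0) (hc0b : c0 ≤ cb0) (hcb0 : cb0 < 1)
    (hc1 : 0 < c1) (hc1b : c1 ≤ cb1) (hcb1 : cb1 < 1)
    (P Pb : ℝ → ℝ)
    (hP : ∀ t : ℝ, Filter.Tendsto
      (fun n : ℕ => (1 / (n : ℝ)) * Real.log (∑ ω ∈ langWords S n, wt c0 c1 ω ^ t))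
      Filter.atTop (nhds (P t)))
    (hPb : ∀ t : ℝ, Filter.Tendsto
      (fun n : ℕ => (1 / (n : ℝ)) * Real.log (∑ ω ∈ langWords S n, wt cb0 cb1 ω ^ t))
      Filter.atTop (nhds (Pb t)))
    (t : ℝ) (ht0 : c0 ^ t < Real.exp (P t)) (ht1 : c1 ^ t < Real.exp (P t)) :
    Qfun S c0 c1 t = (P t : EReal) := by
  have hw : ∀ w, 0 < wt c0 c1 w ^ t := fun w => Real.rpow_pos_of_pos (wt_pos hc0 hc1 w) t
  have hg0 : ∀ n, 0 ≤ ∑ w ∈ coreWords S n, wt c0 c1 w ^ t :=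
    fun n => Finset.sum_nonneg fun w _ => (hw w).le
  apply le_antisymm
  · have hlim := ((continuous_coe_real_ereal.tendsto (P t)).comp (hP t)).limsup_eq
    rw [← hlim]
    refine limsup_le_limsup ?_
    filter_upwards [eventually_gt_atTop 0] with n hn
    rcases (hg0 n).eq_or_lt' with h0 | hpos
    · rw [h0, inv_mul_elog_zero hn]
      exact bot_le
    · rw [elog_of_pos hpos, ← EReal.coe_mul, Function.comp_apply, EReal.coe_le_coe_iff]
      gcongr
      · exact fun w _ _ => (hw w).le
      · exact coreWords_subset_langWords S n
  · by_contra! hlt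
    have hx : 0 < c0 ^ t := Real.rpow_pos_of_pos hc0 t
    have hxP : ((Real.log (c0 ^ t) : ℝ) : EReal) < P t := by
      rw [EReal.coe_lt_coe_iff]
      exact (Real.log_lt_iff_lt_exp hx).2 ht0
    obtain ⟨r, hr, hrP⟩ := EReal.lt_iff_exists_real_btwn.1 (max_lt hlt hxP)
    rw [max_lt_iff] at hr
    rw [EReal.coe_lt_coe_iff] at hrP
    have hxr : c0 ^ t ≤ Real.exp r :=
      ((Real.log_lt_iff_lt_exp hx).1 (EReal.coe_lt_coe_iff.1 hr.2)).le
    have hev : ∀ᶠ n in atTop, ∑ w ∈ coreWords S n, wt c0 c1 w ^ t ≤ Real.exp r ^ n := by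
      filter_upwards [eventually_lt_of_limsup_lt hr.1, eventually_gt_atTop 0] with n hn hn0
      rcases (hg0 n).eq_or_lt' with h0 | hpos
      · rw [h0]
        positivity
      · rw [elog_of_pos hpos, ← EReal.coe_mul, EReal.coe_lt_coe_iff, one_div_mul_eq_div,
          div_lt_iff₀ (by exact_mod_cast hn0), Real.log_lt_iff_lt_exp hpos] at hn
        rw [← Real.exp_nat_mul, mul_comm]
        exact hn.le
    obtain ⟨C, hC, hCg⟩ := exists_forall_le_mul_pow hg0 (Real.exp_pos r) hev
    obtain ⟨D, hD, hDZ⟩ := exists_sum_langWords_le hc0 hc1 t S hC hxr hCg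
    refine hrP.not_ge (le_of_tendsto_of_tendsto' (hP t) (tendsto_log_quadratic_mul_exp hD r)
      fun n => ?_)
    have := sum_langWords_pos hc0 hc1 t S n
    gcongr
    exact hDZ n
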